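/- (Covering time estimate) Fix 0 < α < 1. There exists a constant C > 0 depending only on α such that for every ε > 0 and every interval J ⊂ S¹ of length at least 2ε, and for every sequence β₁, β₂, … ∈ (0, α], there exists n ≤ C ε^{−α} such that T_{β_n} ∘ ⋯ ∘ T_{β_1}(J) = S¹; i.e. the minimal covering time n'_ε over all intervals of length 2ε and all admissible sequences satisfies n'_ε = O(ε^{−α}). -/

import Mathlib

open MeasureTheory Set

/-- The Pomeau–Manneville type map `T_β` on `[0,1]` (identified with the circle `S¹`):
`T_β x = x + 3^β/2^(1+β) x^(1+β)` for `x ≤ 2/3` and `T_β x = 3x - 2` otherwise. -/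
noncomputable def Tmap (β x : ℝ) : ℝ :=
  if x ≤ 2/3 then x + (3:ℝ)^β / 2^(1+β) * x^(1+β) else 3*x - 2

/-- The derivative of `T_β` (left-branch formula at `x ≤ 2/3`). -/
noncomputable def Tderiv (β x : ℝ) : ℝ :=
  if x ≤ 2/3 then 1 + (3:ℝ)^β / 2^(1+β) * (1+β) * x^β else 3

/-- The second derivative of `T_β`. -/
noncomputable def Tderiv2 (β x : ℝ) : ℝ :=
  if x ≤ 2/3 then (3:ℝ)^β / 2^(1+β) * (1+β) * β * x^(β-1) else 0

/-- The inverse of the left branch of `T_β` (for `x ∈ [0,1]` this is the unique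
`y ∈ [0,2/3]` with `T_β y = x`). -/
noncomputable def leftInv (β x : ℝ) : ℝ :=
  sSup {y : ℝ | y ∈ Set.Icc (0:ℝ) (2/3) ∧ Tmap β y ≤ x}

/-- The Perron–Frobenius transfer operator of `T_β` with respect to Lebesgue measure:
`P_β f (x) = ∑_{y ∈ T_β⁻¹ x} f y / T_β' y`; the right branch preimage of `x` is `(x+2)/3`,
where the derivative is `3`. -/
noncomputable def Pop (β : ℝ) (f : ℝ → ℝ) (x : ℝ) : ℝ :=
  f (leftInv β x) / Tderiv β (leftInv β x) + f ((x+2)/3) / 3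

/-- `P_{β_{k+n}} ∘ ⋯ ∘ P_{β_{k+1}}`. -/
noncomputable def PopCompFrom (β : ℕ → ℝ) (k : ℕ) : ℕ → (ℝ → ℝ) → ℝ → ℝ
  | 0, f => f
  | n+1, f => Pop (β (k+n+1)) (PopCompFrom β k n f)

/-- `P_{β_n} ∘ ⋯ ∘ P_{β_1}`. -/
noncomputable def PopComp (β : ℕ → ℝ) (n : ℕ) : (ℝ → ℝ) → ℝ → ℝ :=
  PopCompFrom β 0 n

/-- `T_{β_{k+n}} ∘ ⋯ ∘ T_{β_{k+1}}`. -/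
noncomputable def TcompFrom (β : ℕ → ℝ) (k : ℕ) : ℕ → ℝ → ℝ
  | 0, x => x
  | n+1, x => Tmap (β (k+n+1)) (TcompFrom β k n x)

/-- The derivative `(T_{β_{k+n}} ∘ ⋯ ∘ T_{β_{k+1}})'(z)`, computed as the product of the
derivatives along the orbit of `z`. -/
noncomputable def DcompFrom (β : ℕ → ℝ) (k n : ℕ) (z : ℝ) : ℝ :=
  ∏ i ∈ Finset.range n, Tderiv (β (k+i+1)) (TcompFrom β k i z)

/-- The averaging operator `A_ε f (x) = (1/(2ε)) ∫_{B_ε(x)} f dm` on the circle,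
realized via the 1-periodic extension of `f`. -/
noncomputable def Aop (ε : ℝ) (f : ℝ → ℝ) (x : ℝ) : ℝ :=
  (1/(2*ε)) * ∫ t in (x-ε)..(x+ε), f (Int.fract t)

/-- The indicator function of the ball `B_ε(z)` of radius `ε` around `z` in the circle `ℝ/ℤ`. -/
noncomputable def ballInd (ε z : ℝ) : ℝ → ℝ :=
  Set.indicator {y : ℝ | ∃ k : ℤ, |y - z - (k:ℝ)| < ε} (fun _ => 1)

/-- The cone `C₁ = {f ∈ C⁰((0,1]) : f ≥ 0, f decreasing, x ↦ x^(α+1) f x increasing}`. -/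
def memC1 (α : ℝ) (f : ℝ → ℝ) : Prop :=
  ContinuousOn f (Set.Ioc 0 1) ∧ (∀ x ∈ Set.Ioc (0:ℝ) 1, 0 ≤ f x) ∧
  AntitoneOn f (Set.Ioc 0 1) ∧ MonotoneOn (fun x : ℝ => x^(α+1) * f x) (Set.Ioc 0 1)

/-- `m(f) = ∫₀¹ f dm` (Lebesgue). -/
noncomputable def mInt (f : ℝ → ℝ) : ℝ := ∫ x in Set.Ioc (0:ℝ) 1, f x

/-- The cone `C₂ = {f ∈ C₁ ∩ L¹(m) : f x ≤ a x^(-α) m(f)}`. -/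
def memC2 (α a : ℝ) (f : ℝ → ℝ) : Prop :=
  memC1 α f ∧ IntegrableOn f (Set.Ioc 0 1) volume ∧
  ∀ x ∈ Set.Ioc (0:ℝ) 1, f x ≤ a * x^(-α) * mInt f

/-- The `L¹(m)` norm on `[0,1]`. -/
noncomputable def L1norm (f : ℝ → ℝ) : ℝ := ∫ x in Set.Ioc (0:ℝ) 1, |f x|

/-- The `C¹` norm `‖f‖_∞ + ‖f'‖_∞` on the circle. -/
noncomputable def C1norm (f : ℝ → ℝ) : ℝ :=
  (⨆ x : Set.Icc (0:ℝ) 1, |f (x:ℝ)|) + ⨆ x : Set.Icc (0:ℝ) 1, |deriv f (x:ℝ)|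

lemma TcompFrom_succ' (β : ℕ → ℝ) (k n : ℕ) (x : ℝ) :
    TcompFrom β k (n + 1) x = TcompFrom β (k + 1) n (Tmap (β (k + 1)) x) := by
  induction n with
  | zero => simp [TcompFrom]
  | succ n ih =>
    rw [TcompFrom, ih, TcompFrom, show k + (n + 1) + 1 = k + 1 + n + 1 by ring]

/-- The concatenation of the `n` maps following time `k` maps `S` onto the circle. -/
def CoversFrom (β : ℕ → ℝ) (k n : ℕ) (S : Set ℝ) : Prop :=
  Ioo (0 : ℝ) 1 ⊆ TcompFrom β k n '' S

lemma CoversFrom.mono {β : ℕ → ℝ} {k n : ℕ} {S S' : Set ℝ} (h : CoversFrom β k n S)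
    (hS : S ⊆ S') : CoversFrom β k n S' :=
  h.trans (image_mono hS)

lemma CoversFrom.of_image {β : ℕ → ℝ} {k n : ℕ} {S S' : Set ℝ}
    (h : CoversFrom β (k + 1) n S') (hS : S' ⊆ Tmap (β (k + 1)) '' S) :
    CoversFrom β k (n + 1) S := by
  intro y hy
  obtain ⟨x, hx, rfl⟩ := h hy
  obtain ⟨z, hz, rfl⟩ := hS hx
  exact ⟨z, hz, TcompFrom_succ' β k n z⟩

/-- If a nonnegative potential drops by at least one along each step until a set with a good
covering time is reached, then it bounds the covering time. -/
lemma exists_coversFrom_of_potential {ι : Type*} (β : ℕ → ℝ) (p : ι → Prop) (S : ι → Set ℝ)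
    (Φ : ι → ℝ) (hΦ : ∀ i, p i → 0 ≤ Φ i)
    (step : ∀ k i, p i → (∃ n : ℕ, (n : ℝ) ≤ Φ i ∧ CoversFrom β k n (S i)) ∨
      ∃ j, p j ∧ Φ j + 1 ≤ Φ i ∧ S j ⊆ Tmap (β (k + 1)) '' S i)
    (k : ℕ) (i : ι) (hi : p i) : ∃ n : ℕ, (n : ℝ) ≤ Φ i ∧ CoversFrom β k n (S i) := by
  obtain ⟨N, hN⟩ := exists_nat_ge (Φ i)
  induction N generalizing k i with
  | zero =>
    rcases step k i hi with h | ⟨j, hj, hle, -⟩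
    · exact h
    · have := hΦ j hj
      push_cast at hN
      linarith
  | succ N ih =>
    rcases step k i hi with h | ⟨j, hj, hle, hsub⟩
    · exact h
    · push_cast at hN
      obtain ⟨n, hn, hc⟩ := ih (k + 1) j hj (by linarith)
      exact ⟨n + 1, by push_cast; linarith, hc.of_image hsub⟩

lemma Tmap_of_le {β x : ℝ} (hx : x ≤ 2 / 3) :
    Tmap β x = x + (3 : ℝ) ^ β / 2 ^ (1 + β) * x ^ (1 + β) := if_pos hx

lemma Tmap_of_lt {β x : ℝ} (hx : 2 / 3 < x) : Tmap β x = 3 * x - 2 := if_neg hx.not_ge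

lemma Tmap_two_thirds (β : ℝ) : Tmap β (2 / 3) = 1 := by
  rw [Tmap_of_le le_rfl, Real.div_rpow (by norm_num) (by norm_num),
    Real.rpow_add (by norm_num : (0 : ℝ) < 3), Real.rpow_one]
  have h2 : (2 : ℝ) ^ (1 + β) ≠ 0 := by positivity
  have h3 : (3 : ℝ) ^ β ≠ 0 := by positivity
  field_simp
  norm_num

lemma sub_le_Tmap_sub {β a b : ℝ} (hβ : 0 < β) (ha : 0 ≤ a) (hab : a ≤ b) (hb : b ≤ 2 / 3) :
    b - a ≤ Tmap β b - Tmap β a := by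
  rw [Tmap_of_le hb, Tmap_of_le (hab.trans hb)]
  have h : (3 : ℝ) ^ β / 2 ^ (1 + β) * a ^ (1 + β) ≤ (3 : ℝ) ^ β / 2 ^ (1 + β) * b ^ (1 + β) := by
    gcongr
  linarith

lemma Tmap_nonneg {β a : ℝ} (ha : 0 ≤ a) (ha' : a ≤ 2 / 3) : 0 ≤ Tmap β a := by
  rw [Tmap_of_le ha']
  positivity

lemma Tmap_le_one {β b : ℝ} (hβ : 0 < β) (hb0 : 0 ≤ b) (hb : b ≤ 2 / 3) : Tmap β b ≤ 1 := by
  have := sub_le_Tmap_sub hβ hb0 hb le_rfl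
  rw [Tmap_two_thirds] at this
  linarith

lemma Tmap_zero {β : ℝ} (hβ : 0 < β) : Tmap β 0 = 0 := by
  rw [Tmap_of_le (by norm_num), Real.zero_rpow (by linarith)]
  simp

lemma le_Tmap {α β b : ℝ} (hβ : 0 < β) (hβα : β ≤ α) (hb0 : 0 < b) (hb : b ≤ 2 / 3) :
    b * (1 + b ^ α / 2) ≤ Tmap β b := by
  rw [Tmap_of_le hb, Real.rpow_add hb0, Real.rpow_add (by norm_num : (0 : ℝ) < 2),
    Real.rpow_one, Real.rpow_one]
  have h1 : b ^ α ≤ b ^ β := Real.rpow_le_rpow_of_exponent_ge hb0 (by linarith) hβα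
  have h2 : (1 : ℝ) / 2 ≤ 3 ^ β / (2 * 2 ^ β) := by
    have : (2 : ℝ) ^ β ≤ 3 ^ β := by gcongr; norm_num
    rw [div_le_div_iff₀ (by norm_num) (by positivity)]
    linarith
  have h3 : 1 / 2 * (b * b ^ α) ≤ 3 ^ β / (2 * 2 ^ β) * (b * b ^ β) := by gcongr
  linarith

lemma Ioo_subset_Tmap_image_left {β a b : ℝ} (hβ : 0 < β) (hab : a ≤ b)
    (hb : b ≤ 2 / 3) : Ioo (Tmap β a) (Tmap β b) ⊆ Tmap β '' Ioo a b := by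
  have hc : ContinuousOn (Tmap β) (Icc a b) := by
    refine ContinuousOn.congr (f := fun x => x + (3 : ℝ) ^ β / 2 ^ (1 + β) * x ^ (1 + β)) ?_
      fun x hx => Tmap_of_le (hx.2.trans hb)
    have := Real.continuous_rpow_const (q := 1 + β) (by linarith)
    fun_prop
  exact intermediate_value_Ioo hab hc

lemma Ioo_subset_Tmap_image_right {β a b : ℝ} (ha : 2 / 3 ≤ a) :
    Ioo (3 * a - 2) (3 * b - 2) ⊆ Tmap β '' Ioo a b := by
  rintro y ⟨hy1, hy2⟩
  refine ⟨(y + 2) / 3, ⟨by linarith, by linarith⟩, ?_⟩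
  rw [Tmap_of_lt (by linarith)]
  ring

lemma one_add_half_rpow_neg_le {α t : ℝ} (hα : 0 < α) (ht0 : 0 ≤ t) (ht1 : t ≤ 1) :
    (1 + t / 2) ^ (-α) ≤ 1 - (1 - (3 / 2 : ℝ) ^ (-α)) * t := by
  have h1 : (3 / 2 : ℝ) ^ t ≤ 1 + t / 2 := by
    have := rpow_one_add_le_one_add_mul_self (s := 1 / 2) (by norm_num) ht0 ht1
    norm_num at this
    linarith
  have h2 : ((3 / 2 : ℝ) ^ (-α)) ^ t ≤ 1 - (1 - (3 / 2 : ℝ) ^ (-α)) * t := by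
    have h0 : 0 < (3 / 2 : ℝ) ^ (-α) := by positivity
    have := rpow_one_add_le_one_add_mul_self (s := (3 / 2 : ℝ) ^ (-α) - 1)
      (by linarith) ht0 ht1
    rw [add_sub_cancel] at this
    linarith
  calc (1 + t / 2) ^ (-α) ≤ ((3 / 2 : ℝ) ^ t) ^ (-α) :=
        Real.rpow_le_rpow_of_nonpos (by positivity) h1 (by linarith)
    _ = ((3 / 2 : ℝ) ^ (-α)) ^ t := by
        rw [← Real.rpow_mul (by norm_num), ← Real.rpow_mul (by norm_num), mul_comm]
    _ ≤ _ := h2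

lemma Tmap_rpow_neg_le {α β b : ℝ} (hβ : 0 < β) (hβα : β ≤ α) (hb0 : 0 < b) (hb : b ≤ 2 / 3) :
    Tmap β b ^ (-α) ≤ b ^ (-α) - (1 - (3 / 2 : ℝ) ^ (-α)) := by
  have hα : 0 < α := hβ.trans_le hβα
  have ht : b ^ α ≤ 1 := Real.rpow_le_one hb0.le (by linarith) hα.le
  calc Tmap β b ^ (-α) ≤ (b * (1 + b ^ α / 2)) ^ (-α) :=
        Real.rpow_le_rpow_of_nonpos (by positivity) (le_Tmap hβ hβα hb0 hb) (by linarith)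
    _ = b ^ (-α) * (1 + b ^ α / 2) ^ (-α) := Real.mul_rpow hb0.le (by positivity)
    _ ≤ b ^ (-α) * (1 - (1 - (3 / 2 : ℝ) ^ (-α)) * b ^ α) := by
        gcongr
        exact one_add_half_rpow_neg_le hα (by positivity) ht
    _ = b ^ (-α) - (1 - (3 / 2 : ℝ) ^ (-α)) := by
        have h : b ^ (-α) * b ^ α = 1 := by rw [← Real.rpow_add hb0]; simp
        linear_combination (-(1 - (3 / 2 : ℝ) ^ (-α))) * h

lemma one_le_rpow_neg {α x : ℝ} (hα : 0 < α) (hx0 : 0 < x) (hx1 : x ≤ 1) : 1 ≤ x ^ (-α) :=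
  Real.one_le_rpow_of_pos_of_le_one_of_nonpos hx0 hx1 (by linarith)

lemma exists_coversFrom_Ioo_zero {α : ℝ} {β : ℕ → ℝ}
    (hβ : ∀ i, β i ∈ Ioc (0 : ℝ) α) {K : ℝ} (hK0 : 0 ≤ K)
    (hK : 1 ≤ K * (1 - (3 / 2 : ℝ) ^ (-α))) (k : ℕ) {w : ℝ} (hw0 : 0 < w) (hw1 : w ≤ 1) :
    ∃ n : ℕ, (n : ℝ) ≤ K * w ^ (-α) + 1 ∧ CoversFrom β k n (Ioo 0 w) := by
  refine exists_coversFrom_of_potential β (fun w : ℝ => 0 < w ∧ w ≤ 1) (fun w => Ioo 0 w)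
    (fun w => K * w ^ (-α) + 1) (fun w hw => ?_) (fun k w hw => ?_) k w ⟨hw0, hw1⟩
  · have := Real.rpow_nonneg hw.1.le (-α)
    positivity
  obtain ⟨hw0, hw1⟩ := hw
  obtain ⟨hβ0, hβα⟩ := hβ (k + 1)
  rcases le_or_gt w (2 / 3) with h | h
  · have hpos : 0 < Tmap (β (k + 1)) w := by
      have := sub_le_Tmap_sub hβ0 le_rfl hw0.le h
      rw [Tmap_zero hβ0] at this
      linarith
    refine .inr ⟨Tmap (β (k + 1)) w, ⟨hpos, Tmap_le_one hβ0 hw0.le h⟩, ?_, ?_⟩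
    · have := mul_le_mul_of_nonneg_left (Tmap_rpow_neg_le hβ0 hβα hw0 h) hK0
      linarith
    · have := Ioo_subset_Tmap_image_left hβ0 hw0.le h
      rwa [Tmap_zero hβ0] at this
  · refine .inl ⟨1, ?_, ?_⟩
    · have := Real.rpow_nonneg hw0.le (-α)
      push_cast
      have : 0 ≤ K * w ^ (-α) := by positivity
      linarith
    · refine CoversFrom.of_image (S' := Ioo 0 1) (by simp [CoversFrom, TcompFrom]) ?_
      have := Ioo_subset_Tmap_image_left hβ0 (by norm_num : (0 : ℝ) ≤ 2 / 3) le_rfl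
      rw [Tmap_zero hβ0, Tmap_two_thirds] at this
      exact this.trans (image_mono (Ioo_subset_Ioo_right h.le))

lemma exists_coversFrom_Ioo_one {α : ℝ} {β : ℕ → ℝ} (hα : 0 < α) {B : ℝ} (hB0 : 0 ≤ B)
    (hB : 1 ≤ B * (1 - (3 : ℝ) ^ (-α))) (k : ℕ) {w : ℝ} (hw0 : 0 < w) (hw1 : w ≤ 1) :
    ∃ n : ℕ, (n : ℝ) ≤ B * w ^ (-α) + 1 ∧ CoversFrom β k n (Ioo (1 - w) 1) := by
  refine exists_coversFrom_of_potential β (fun w : ℝ => 0 < w ∧ w ≤ 1) (fun w => Ioo (1 - w) 1)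
    (fun w => B * w ^ (-α) + 1) (fun w hw => ?_) (fun k w hw => ?_) k w ⟨hw0, hw1⟩
  · have := Real.rpow_nonneg hw.1.le (-α)
    positivity
  obtain ⟨hw0, hw1⟩ := hw
  have hw := one_le_rpow_neg hα hw0 hw1
  rcases le_or_gt w (1 / 3) with h | h
  · refine .inr ⟨3 * w, ⟨by linarith, by linarith⟩, ?_, ?_⟩
    · rw [Real.mul_rpow (by norm_num) hw0.le]
      nlinarith
    · have := Ioo_subset_Tmap_image_right (β := β (k + 1)) (a := 1 - w) (b := 1) (by linarith)
      convert this using 2 <;> ring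
  · refine .inl ⟨1, ?_, ?_⟩
    · have : 0 ≤ B * w ^ (-α) := by positivity
      push_cast
      linarith
    · refine CoversFrom.of_image (S' := Ioo 0 1) (by simp [CoversFrom, TcompFrom]) ?_
      have := Ioo_subset_Tmap_image_right (β := β (k + 1)) (b := 1) (le_refl (2 / 3 : ℝ))
      norm_num at this
      exact this.trans (image_mono (Ioo_subset_Ioo_left (by linarith)))

lemma rpow_neg_le_two_mul {α L w : ℝ} (hα0 : 0 < α) (hα1 : α < 1) (hL : 0 < L)
    (hw : L / 2 ≤ w) : w ^ (-α) ≤ 2 * L ^ (-α) := by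
  have h2 : ((1 : ℝ) / 2) ^ (-α) ≤ 2 := by
    rw [one_div, Real.inv_rpow (by norm_num), Real.rpow_neg (by norm_num), inv_inv]
    calc (2 : ℝ) ^ α ≤ 2 ^ (1 : ℝ) := by gcongr; norm_num
      _ = 2 := Real.rpow_one 2
  calc w ^ (-α) ≤ (1 / 2 * L) ^ (-α) :=
        Real.rpow_le_rpow_of_nonpos (by positivity) (by linarith) (by linarith)
    _ = (1 / 2) ^ (-α) * L ^ (-α) := Real.mul_rpow (by norm_num) hL.le
    _ ≤ 2 * L ^ (-α) := by gcongr

/-- After one step, an interval straddling the point `2/3` contains a one-sided neighbourhood of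
the fixed point of length comparable to its own. -/
lemma exists_coversFrom_of_straddle {α : ℝ} (hα0 : 0 < α) (hα1 : α < 1) {β : ℕ → ℝ}
    (hβ : ∀ i, β i ∈ Ioc (0 : ℝ) α) {K B : ℝ} (hK0 : 0 ≤ K) (hB0 : 0 ≤ B)
    (hK : 1 ≤ K * (1 - (3 / 2 : ℝ) ^ (-α))) (hB : 1 ≤ B * (1 - (3 : ℝ) ^ (-α)))
    (k : ℕ) {a b : ℝ} (ha0 : 0 ≤ a) (ha : a < 2 / 3) (hb : 2 / 3 < b) (hb1 : b ≤ 1) :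
    ∃ n : ℕ, (n : ℝ) ≤ (2 + 2 * K + 2 * B) * (b - a) ^ (-α) ∧ CoversFrom β k n (Ioo a b) := by
  have hL : 0 < b - a := by linarith
  have hL1 := one_le_rpow_neg hα0 hL (by linarith)
  obtain ⟨hβ0, hβα⟩ := hβ (k + 1)
  have key : ∃ n : ℕ, ∃ S' : Set ℝ, (n : ℝ) ≤ (2 * K + 2 * B) * (b - a) ^ (-α) + 1 ∧
      S' ⊆ Tmap (β (k + 1)) '' Ioo a b ∧ CoversFrom β (k + 1) n S' := by
    rcases le_or_gt ((b - a) / 2) (b - 2 / 3) with h | h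
    · obtain ⟨n, hn, hc⟩ := exists_coversFrom_Ioo_zero hβ hK0 hK (k + 1)
        (w := 3 * b - 2) (by linarith) (by linarith)
      refine ⟨n, _, ?_, ?_, hc⟩
      · have := mul_le_mul_of_nonneg_left
          (rpow_neg_le_two_mul hα0 hα1 hL (w := 3 * b - 2) (by linarith)) hK0
        have : 0 ≤ B * (b - a) ^ (-α) := by positivity
        linarith
      · have := Ioo_subset_Tmap_image_right (β := β (k + 1)) (b := b) (le_refl (2 / 3 : ℝ))
        norm_num at this
        exact this.trans (image_mono (Ioo_subset_Ioo_left ha.le))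
    · have hexp := sub_le_Tmap_sub hβ0 ha0 ha.le le_rfl
      rw [Tmap_two_thirds] at hexp
      have hnn := Tmap_nonneg (β := β (k + 1)) ha0 ha.le
      obtain ⟨n, hn, hc⟩ := exists_coversFrom_Ioo_one (β := β) hα0 hB0 hB (k + 1)
        (w := 1 - Tmap (β (k + 1)) a) (by linarith) (by linarith)
      refine ⟨n, _, ?_, ?_, hc⟩
      · have := mul_le_mul_of_nonneg_left
          (rpow_neg_le_two_mul hα0 hα1 hL (w := 1 - Tmap (β (k + 1)) a) (by linarith)) hB0
        have : 0 ≤ K * (b - a) ^ (-α) := by positivity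
        linarith
      · have := Ioo_subset_Tmap_image_left hβ0 ha.le le_rfl
        rw [Tmap_two_thirds] at this
        rw [sub_sub_cancel]
        exact this.trans (image_mono (Ioo_subset_Ioo_right hb.le))
  obtain ⟨n, S', hn, hS, hc⟩ := key
  exact ⟨n + 1, by push_cast; linarith, hc.of_image hS⟩

lemma exists_coversFrom_Ioo {α : ℝ} (hα0 : 0 < α) (hα1 : α < 1) {β : ℕ → ℝ}
    (hβ : ∀ i, β i ∈ Ioc (0 : ℝ) α) {K B : ℝ} (hK0 : 0 ≤ K) (hB0 : 0 ≤ B)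
    (hK : 1 ≤ K * (1 - (3 / 2 : ℝ) ^ (-α))) (hB : 1 ≤ B * (1 - (3 : ℝ) ^ (-α)))
    (k : ℕ) {a b : ℝ} (ha0 : 0 ≤ a) (hab : a < b) (hb1 : b ≤ 1) :
    ∃ n : ℕ, (n : ℝ) ≤ K * b ^ (-α) + (2 + 2 * K) * (1 + B) * (b - a) ^ (-α) ∧
      CoversFrom β k n (Ioo a b) := by
  refine exists_coversFrom_of_potential β (fun I : ℝ × ℝ => 0 ≤ I.1 ∧ I.1 < I.2 ∧ I.2 ≤ 1)
    (fun I => Ioo I.1 I.2)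
    (fun I => K * I.2 ^ (-α) + (2 + 2 * K) * (1 + B) * (I.2 - I.1) ^ (-α))
    ?_ ?_ k (a, b) ⟨ha0, hab, hb1⟩
  · rintro ⟨a, b⟩ ⟨ha0, hab, hb1⟩
    have h1 := Real.rpow_nonneg (ha0.trans hab.le) (-α)
    have h2 := Real.rpow_nonneg (sub_pos.2 hab).le (-α)
    positivity
  rintro k ⟨a, b⟩ ⟨ha0, hab, hb1⟩
  dsimp only at ha0 hab hb1 ⊢
  obtain ⟨hβ0, hβα⟩ := hβ (k + 1)
  have hb0 : 0 < b := ha0.trans_lt hab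
  have hL : 0 < b - a := sub_pos.2 hab
  have hL1 := one_le_rpow_neg hα0 hL (by linarith)
  have hb1' := one_le_rpow_neg hα0 hb0 hb1
  rcases le_or_gt b (2 / 3) with hb | hb
  · have hexp := sub_le_Tmap_sub hβ0 ha0 hab.le hb
    refine .inr ⟨(Tmap (β (k + 1)) a, Tmap (β (k + 1)) b),
      ⟨Tmap_nonneg ha0 (hab.le.trans hb), by dsimp only; linarith, Tmap_le_one hβ0 hb0.le hb⟩, ?_,
      Ioo_subset_Tmap_image_left hβ0 hab.le hb⟩
    dsimp only
    have h1 := mul_le_mul_of_nonneg_left (Tmap_rpow_neg_le hβ0 hβα hb0 hb) hK0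
    have h2 : (2 + 2 * K) * (1 + B) * (Tmap (β (k + 1)) b - Tmap (β (k + 1)) a) ^ (-α) ≤
        (2 + 2 * K) * (1 + B) * (b - a) ^ (-α) :=
      mul_le_mul_of_nonneg_left (Real.rpow_le_rpow_of_nonpos hL hexp (by linarith))
        (by positivity)
    linarith
  rcases le_or_gt (2 / 3) a with ha | ha
  · refine .inr ⟨(3 * a - 2, 3 * b - 2), ⟨by dsimp only; linarith, by dsimp only; linarith,
      by dsimp only; linarith⟩, ?_, Ioo_subset_Tmap_image_right ha⟩
    dsimp only
    set q : ℝ := (3 : ℝ) ^ (-α)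
    have hq1 : q ≤ 1 := Real.rpow_le_one_of_one_le_of_nonpos (by norm_num) (by linarith)
    have h3 : (3 * (b - a)) ^ (-α) = q * (b - a) ^ (-α) := Real.mul_rpow (by norm_num) hL.le
    have h4 : (3 * b - 2) ^ (-α) ≤ q * (b - a) ^ (-α) :=
      h3 ▸ Real.rpow_le_rpow_of_nonpos (by linarith) (by linarith) (by linarith)
    rw [show 3 * b - 2 - (3 * a - 2) = 3 * (b - a) by ring, h3]
    have h5 : (3 * b - 2) ^ (-α) ≤ (b - a) ^ (-α) :=
      h4.trans (mul_le_of_le_one_left (by positivity) hq1)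
    have h6 := mul_le_mul_of_nonneg_left h5 hK0
    have h7 : (2 + 2 * K) * (b - a) ^ (-α) ≤
        (2 + 2 * K) * ((1 + B) * (1 - q)) * (b - a) ^ (-α) := by
      gcongr
      refine le_mul_of_one_le_right (by positivity) ?_
      linarith
    have h8 : 0 ≤ K * b ^ (-α) := by positivity
    have h9 : 0 ≤ K * (b - a) ^ (-α) := by positivity
    linarith
  · obtain ⟨n, hn, hc⟩ :=
      exists_coversFrom_of_straddle hα0 hα1 hβ hK0 hB0 hK hB k ha0 ha hb hb1
    refine .inl ⟨n, ?_, hc⟩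
    have h1 : 0 ≤ K * b ^ (-α) := by positivity
    have h2 : 0 ≤ K * B * (b - a) ^ (-α) := by positivity
    linarith

/-- Covering time estimate: there is `C > 0` depending only on `α` such
that for every `ε > 0`, every interval `J = [u,v] ⊆ S¹` of length at least `2ε` and every
sequence of `β`'s in `(0,α]`, there is `n ≤ C ε^{-α}` with
`T_{β_n} ∘ ⋯ ∘ T_{β_1}(J) = S¹` (covering the whole circle, i.e. all of `(0,1)` in the
fundamental domain `[0,1]`). -/
theorem covering_time_estimate (α : ℝ) (hα0 : 0 < α) (hα1 : α < 1) :
    ∃ C > 0, ∀ ε > 0, ∀ u v : ℝ, Set.Icc u v ⊆ Set.Icc (0:ℝ) 1 → 2*ε ≤ v - u →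
      ∀ β : ℕ → ℝ, (∀ i, β i ∈ Set.Ioc (0:ℝ) α) →
      ∃ n : ℕ, (n:ℝ) ≤ C * ε^(-α) ∧
        Set.Ioo (0:ℝ) 1 ⊆ TcompFrom β 0 n '' Set.Icc u v := by
  have h32 : (3 / 2 : ℝ) ^ (-α) < 1 :=
    Real.rpow_lt_one_of_one_lt_of_neg (by norm_num) (by linarith)
  have h3 : (3 : ℝ) ^ (-α) < 1 :=
    Real.rpow_lt_one_of_one_lt_of_neg (by norm_num) (by linarith)
  have hK := sub_pos.2 h32
  have hB := sub_pos.2 h3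
  set K : ℝ := (1 - (3 / 2 : ℝ) ^ (-α))⁻¹ with hKdef
  set B : ℝ := (1 - (3 : ℝ) ^ (-α))⁻¹ with hBdef
  have hK0 : 0 < K := inv_pos.2 hK
  have hB0 : 0 < B := inv_pos.2 hB
  refine ⟨K + (2 + 2 * K) * (1 + B), by positivity, fun ε hε u v huv hlen β hβ => ?_⟩
  have hlt : u < v := by linarith
  have hu := huv (left_mem_Icc.2 hlt.le)
  have hv := huv (right_mem_Icc.2 hlt.le)
  obtain ⟨n, hn, hc⟩ := exists_coversFrom_Ioo hα0 hα1 hβ hK0.le hB0.le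
    (inv_mul_cancel₀ hK.ne').ge (inv_mul_cancel₀ hB.ne').ge 0 hu.1 hlt hv.2
  refine ⟨n, hn.trans ?_, hc.mono Ioo_subset_Icc_self⟩
  have h1 : v ^ (-α) ≤ ε ^ (-α) :=
    Real.rpow_le_rpow_of_nonpos hε (by linarith [hu.1]) (by linarith)
  have h2 : (v - u) ^ (-α) ≤ ε ^ (-α) :=
    Real.rpow_le_rpow_of_nonpos hε (by linarith) (by linarith)
  rw [add_mul K]
  gcongr
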